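/- For any directed graph G⃗ on [n], the number of strongly connected components of G⃗ containing at least two vertices is at most the number of surplus edges of G⃗ plus the number of ancestral back edges of G⃗ (both defined with respect to the forward depth-first exploration of G⃗). -/

import Mathlib

/-!
The forward depth-first forest of the random directed graph `G⃗(n,p)` has the same
distribution as the depth-first forest of the Erdős–Rényi graph `G(n,p)`.

Graphs on `[n] = {1,…,n}` are encoded as functions `Fin n → Fin n → Bool` (adjacency,
`d u w = true` meaning there is a (directed) edge from `u` to `w`); vertex `1` corresponds
to `(0 : Fin n)` and the increasing order on labels is the order on `Fin n`.
-/

open Finset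

namespace DFSExploration

/-- The state of the depth-first exploration: the ordered stack `𝒪ᵢ` of open vertices, the
list of explored vertices (in order of exploration), and the list of forest edges found. -/
structure State (n : ℕ) where
  stack : List (Fin n)
  visited : List (Fin n)
  forest : List (Fin n × Fin n)

/-- One step of the depth-first exploration of the (directed) graph with adjacency `adj`:
the first vertex `v` of the stack is explored; its (out-)neighbours which have not been
seen yet are added at the front of the stack, in increasing order; if the stack becomes
empty, the smallest unexplored vertex is put on it. -/
def step {n : ℕ} (adj : Fin n → Fin n → Bool) (s : State n) : State n :=
  match s.stack with
  | [] => s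
  | v :: rest =>
    let visited' := s.visited ++ [v]
    let ns := (List.finRange n).filter
      (fun w => adj v w && !(decide (w ∈ s.stack)) && !(decide (w ∈ s.visited)))
    let stack' := ns ++ rest
    let stack'' := if stack'.isEmpty then
        ((List.finRange n).filter (fun w => !(decide (w ∈ visited')))).take 1
      else stack'
    ⟨stack'', visited', s.forest ++ ns.map (fun w => (v, w))⟩

/-- The result of running the depth-first exploration, started from vertex `1`
(i.e. `0 : Fin n`). -/
def run {n : ℕ} (adj : Fin n → Fin n → Bool) : State n :=
  (step adj)^[n] ⟨(List.finRange n).take 1, [], []⟩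

/-- The depth-first forest of a graph, as the list of its edges `(vᵢ, w)`, `w ∈ 𝒩ᵢ`, in
order of appearance.  For a directed graph this is the forward depth-first forest
`F_{G⃗}`; for an undirected graph (symmetric adjacency function) it is the depth-first
forest `F_G`. -/
def dfsForest {n : ℕ} (adj : Fin n → Fin n → Bool) : List (Fin n × Fin n) :=
  (run adj).forest


/-- The position of a vertex in the depth-first order `v₀, v₁, …, v_{n-1}`. -/
def dfsPos {n : ℕ} (adj : Fin n → Fin n → Bool) (v : Fin n) : ℕ :=
  (run adj).visited.findIdx (fun w => decide (w = v))

/-- Reachability by a directed path in the directed graph `d`. -/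
def Reaches {n : ℕ} (d : Fin n → Fin n → Bool) : Fin n → Fin n → Prop :=
  Relation.ReflTransGen (fun a b => d a b = true)

/-- Two vertices lie in the same strongly connected component. -/
def SameSCC {n : ℕ} (d : Fin n → Fin n → Bool) (u v : Fin n) : Prop :=
  Reaches d u v ∧ Reaches d v u

/-- The strongly connected component of a vertex, as a set of vertices. -/
def scc {n : ℕ} (d : Fin n → Fin n → Bool) (v : Fin n) : Set (Fin n) :=
  {w | SameSCC d v w}

/-- The set of surplus edges of `d`: forward edges (increasing for the depth-first
order) which are not edges of the forward depth-first forest. -/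
def surplusEdges {n : ℕ} (d : Fin n → Fin n → Bool) : Set (Fin n × Fin n) :=
  {x | d x.1 x.2 = true ∧ dfsPos d x.1 < dfsPos d x.2 ∧ x ∉ dfsForest d}

/-- Ancestry in the forward depth-first forest of `d`. -/
def ForestAncestor {n : ℕ} (d : Fin n → Fin n → Bool) : Fin n → Fin n → Prop :=
  Relation.ReflTransGen (fun a b => (a, b) ∈ dfsForest d)

/-- The set of ancestral back edges of `d`: edges decreasing for the depth-first order
whose head is an ancestor of their tail in the forward depth-first forest. -/
def ancestralBackEdges {n : ℕ} (d : Fin n → Fin n → Bool) : Set (Fin n × Fin n) :=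
  {x | d x.1 x.2 = true ∧ dfsPos d x.2 < dfsPos d x.1 ∧ ForestAncestor d x.2 x.1}

end DFSExploration

namespace DFSExploration

variable {n : ℕ}

/-- The order of the vertices seen so far in the exploration: the explored vertices, followed by
the stack. -/
def State.order (s : State n) : List (Fin n) := s.visited ++ s.stack

/-- The properties of the state of an exploration that are preserved by `step`. -/
structure State.Good (s : State n) : Prop where
  nodup : s.order.Nodup
  mem_visited_of_stack_eq_nil : s.stack = [] → ∀ w, w ∈ s.visited
  mem_order : ∀ a b, (a, b) ∈ s.forest → a ∈ s.order ∧ b ∈ s.order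
  ancestor_of_between : ∀ a b, (a, b) ∈ s.forest → ∀ x,
    s.order.idxOf a < s.order.idxOf x → s.order.idxOf x < s.order.idxOf b →
    Relation.ReflTransGen (fun a b => (a, b) ∈ s.forest) a x

section Insert

variable {α : Type*} [DecidableEq α] {A N R F : List α} {v a b x : α}

lemma idxOf_lt_of_idxOf_insert_lt (hnd : (A ++ v :: (N ++ R ++ F)).Nodup)
    (ha : a ∈ A ++ v :: R) (hb : b ∈ A ++ v :: R) (hav : a ≠ v) (hx : x ∈ N)
    (hax : (A ++ v :: (N ++ R ++ F)).idxOf a < (A ++ v :: (N ++ R ++ F)).idxOf x)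
    (hxb : (A ++ v :: (N ++ R ++ F)).idxOf x < (A ++ v :: (N ++ R ++ F)).idxOf b) :
    (A ++ v :: R).idxOf a < (A ++ v :: R).idxOf v ∧
      (A ++ v :: R).idxOf v < (A ++ v :: R).idxOf b := by
  have hN := List.idxOf_lt_length_of_mem hx
  simp only [List.nodup_append, List.nodup_cons, List.mem_append, List.mem_cons] at hnd ha hb
  simp only [List.idxOf_append, List.idxOf_cons, List.mem_append] at *
  grind

lemma idxOf_lt_of_notMem_insert (hnd : (A ++ v :: (N ++ R ++ F)).Nodup)
    (ha : a ∈ A ++ v :: R) (hb : b ∈ A ++ v :: R) (hx : x ∉ N)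
    (hax : (A ++ v :: (N ++ R ++ F)).idxOf a < (A ++ v :: (N ++ R ++ F)).idxOf x)
    (hxb : (A ++ v :: (N ++ R ++ F)).idxOf x < (A ++ v :: (N ++ R ++ F)).idxOf b) :
    (A ++ v :: R).idxOf a < (A ++ v :: R).idxOf x ∧
      (A ++ v :: R).idxOf x < (A ++ v :: R).idxOf b := by
  have hR : b ∈ R → _ := List.idxOf_lt_length_of_mem
  simp only [List.nodup_append, List.nodup_cons, List.mem_append, List.mem_cons] at hnd ha hb
  simp only [List.idxOf_append, List.idxOf_cons, List.mem_append] at *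
  grind

lemma mem_of_idxOf_lt (hnd : (A ++ v :: (N ++ R ++ F)).Nodup) (hb : b ∈ N)
    (hvx : (A ++ v :: (N ++ R ++ F)).idxOf v < (A ++ v :: (N ++ R ++ F)).idxOf x)
    (hxb : (A ++ v :: (N ++ R ++ F)).idxOf x < (A ++ v :: (N ++ R ++ F)).idxOf b) :
    x ∈ N := by
  have hN := List.idxOf_lt_length_of_mem hb
  have hA : x ∈ A → _ := List.idxOf_lt_length_of_mem
  simp only [List.nodup_append, List.nodup_cons, List.mem_append, List.mem_cons] at hnd
  simp only [List.idxOf_append, List.idxOf_cons, List.mem_append] at *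
  grind

end Insert

/-- One step of the exploration inserts the list `ns` of new out-neighbours just after the explored
vertex, and possibly appends a new root `refill`. -/
lemma step_eq (d : Fin n → Fin n → Bool) {s : State n} {v : Fin n} {rest : List (Fin n)}
    (hs : s.stack = v :: rest) (hnd : s.order.Nodup) :
    ∃ ns refill : List (Fin n),
      step d s = ⟨ns ++ rest ++ refill, s.visited ++ [v],
        s.forest ++ ns.map (fun w => (v, w))⟩ ∧
      (s.visited ++ v :: (ns ++ rest ++ refill)).Nodup ∧
      (ns ++ rest ++ refill = [] → ∀ w, w ∈ s.visited ++ [v]) := by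
  set ns := (List.finRange n).filter
      (fun w => d v w && !(decide (w ∈ s.stack)) && !(decide (w ∈ s.visited))) with hns
  set fresh := (List.finRange n).filter (fun w => !(decide (w ∈ s.visited ++ [v]))) with hfresh
  have hns_nodup : ns.Nodup := (List.nodup_finRange n).filter _
  have hfresh_nodup : (fresh.take 1).Nodup :=
    ((List.nodup_finRange n).filter _).sublist (List.take_sublist _ _)
  have hns_mem : ∀ w ∈ ns, w ∉ v :: rest ∧ w ∉ s.visited := by
    intro w hw
    simp only [hns, hs, List.mem_filter] at hw
    simp_all
  have hfresh_mem : ∀ w ∈ fresh.take 1, w ∉ s.visited ++ [v] := by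
    intro w hw
    have := List.mem_of_mem_take hw
    simp only [hfresh, List.mem_filter] at this
    simpa using this.2
  rw [State.order, hs] at hnd
  refine ⟨ns, if (ns ++ rest).isEmpty then fresh.take 1 else [], ?_, ?_, ?_⟩
  · unfold step
    simp only [hs]
    rw [hs] at hns
    by_cases h : (ns ++ rest).isEmpty
    · have h' := List.isEmpty_iff.1 h
      simp only [← hns, ← hfresh, h', List.nil_append]
    · simp only [← hns, ← hfresh, h]
      simp
  · split_ifs with h
    · have h' := List.isEmpty_iff.1 h
      rw [h', List.nil_append]
      grind
    · grind
  · split_ifs with h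
    · have h' := List.isEmpty_iff.1 h
      rw [h', List.nil_append, List.take_eq_nil_iff]
      rintro (h | h) w
      · cases h
      · by_contra hw
        have : w ∈ fresh := by
          rw [hfresh, List.mem_filter]
          simpa using hw
        simp [h] at this
    · intro h'
      simp_all

lemma State.Good.step (d : Fin n → Fin n → Bool) {s : State n} (h : s.Good) :
    (step d s).Good := by
  rcases hs : s.stack with _ | ⟨v, rest⟩
  · have : DFSExploration.step d s = s := by simp [DFSExploration.step, hs]
    rwa [this]
  obtain ⟨ns, refill, heq, hnd, hnil⟩ := step_eq d hs h.nodup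
  have hmem := h.mem_order
  have hbet := h.ancestor_of_between
  rw [heq]
  have hord : s.order = s.visited ++ v :: rest := by rw [State.order, hs]
  have hord' : (⟨ns ++ rest ++ refill, s.visited ++ [v],
      s.forest ++ ns.map (fun w => (v, w))⟩ : State n).order =
      s.visited ++ v :: (ns ++ rest ++ refill) := by simp [State.order]
  refine ⟨by rwa [hord'], hnil, ?_, ?_⟩
  · intro a b hab
    rw [hord']
    simp only [List.mem_append, List.mem_map, Prod.mk.injEq] at hab
    rcases hab with hab | ⟨w, hw, rfl, rfl⟩
    · have := hmem a b hab
      grind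
    · grind
  · intro a b hab x hax hxb
    rw [hord'] at hax hxb
    have hmono : ∀ {y z}, Relation.ReflTransGen (fun a b => (a, b) ∈ s.forest) y z →
        Relation.ReflTransGen
          (fun a b => (a, b) ∈ s.forest ++ ns.map (fun w => (v, w))) y z :=
      fun hyz => Relation.ReflTransGen.mono (fun _ _ hm => List.mem_append_left _ hm) _ _ hyz
    have hnew : ∀ w ∈ ns, (v, w) ∈ s.forest ++ ns.map (fun w => (v, w)) := fun w hw =>
      List.mem_append_right _ (List.mem_map_of_mem hw)
    simp only [List.mem_append, List.mem_map, Prod.mk.injEq] at hab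
    rcases hab with hab | ⟨w, hw, rfl, rfl⟩
    · obtain ⟨ha, hb⟩ := hmem a b hab
      have hbet := hbet a b hab
      rw [hord] at ha hb hbet
      by_cases hx : x ∈ ns
      · rcases eq_or_ne a v with rfl | hav
        · exact .single (hnew x hx)
        · obtain ⟨hav', hvb⟩ := idxOf_lt_of_idxOf_insert_lt hnd ha hb hav hx hax hxb
          exact .tail (hmono (hbet v hav' hvb)) (hnew x hx)
      · obtain ⟨hax', hxb'⟩ := idxOf_lt_of_notMem_insert hnd ha hb hx hax hxb
        exact hmono (hbet x hax' hxb')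
    · exact .single (hnew x (mem_of_idxOf_lt hnd hw hax hxb))

lemma good_iterate_step (d : Fin n → Fin n → Bool) (k : ℕ) :
    ((step d)^[k] ⟨(List.finRange n).take 1, [], []⟩).Good := by
  induction k with
  | zero =>
    refine ⟨?_, ?_, by simp, by simp⟩
    · simpa [State.order] using (List.nodup_finRange n).sublist (List.take_sublist _ _)
    · intro h w
      have : n = 0 := by simpa using h
      subst this
      exact w.elim0
  | succ k ih =>
    rw [Function.iterate_succ_apply']
    exact ih.step d

lemma stack_eq_nil_or_length_visited (d : Fin n → Fin n → Bool) (k : ℕ) :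
    ((step d)^[k] ⟨(List.finRange n).take 1, [], []⟩).stack = [] ∨
      ((step d)^[k] ⟨(List.finRange n).take 1, [], []⟩).visited.length = k := by
  induction k with
  | zero => simp
  | succ k ih =>
    rw [Function.iterate_succ_apply']
    generalize (step d)^[k] ⟨(List.finRange n).take 1, [], []⟩ = s at ih
    rcases hs : s.stack with _ | ⟨v, rest⟩
    · simp [step, hs]
    · simp_all [step]

lemma mem_visited_run (d : Fin n → Fin n → Bool) (w : Fin n) : w ∈ (run d).visited := by
  have hgood : (run d).Good := good_iterate_step d n
  rcases stack_eq_nil_or_length_visited d n with h | h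
  · exact hgood.mem_visited_of_stack_eq_nil h w
  · have hnd : (run d).visited.Nodup := hgood.nodup.sublist (List.sublist_append_left _ _)
    have huniv : (run d).visited.toFinset = Finset.univ :=
      Finset.eq_univ_of_card _ (by
        rw [List.toFinset_card_of_nodup hnd, Fintype.card_fin]; exact h)
    simpa using huniv.symm.subset (Finset.mem_univ w)

lemma dfsPos_eq_idxOf_visited (d : Fin n → Fin n → Bool) (w : Fin n) :
    dfsPos d w = (run d).visited.idxOf w := by
  simp only [dfsPos, List.idxOf]
  congr 1

lemma dfsPos_eq_idxOf_order (d : Fin n → Fin n → Bool) (w : Fin n) :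
    dfsPos d w = (run d).order.idxOf w := by
  rw [dfsPos_eq_idxOf_visited, State.order, List.idxOf_append_of_mem (mem_visited_run d w)]

lemma dfsPos_injective (d : Fin n → Fin n → Bool) : Function.Injective (dfsPos d) := by
  intro u w h
  rw [dfsPos_eq_idxOf_visited, dfsPos_eq_idxOf_visited] at h
  exact (List.idxOf_inj (mem_visited_run d u)).1 h

/-- The descendants of a vertex form an interval of the depth-first order. -/
lemma ForestAncestor.of_dfsPos_le {d : Fin n → Fin n → Bool} {a u x : Fin n}
    (hau : ForestAncestor d a u) (hax : dfsPos d a ≤ dfsPos d x)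
    (hxu : dfsPos d x ≤ dfsPos d u) : ForestAncestor d a x := by
  induction hau with
  | refl => rw [dfsPos_injective d (le_antisymm hax hxu)]; exact .refl
  | @tail c u hac hcu ih =>
    rcases le_or_gt (dfsPos d x) (dfsPos d c) with hxc | hcx
    · exact ih hxc
    rcases hxu.eq_or_lt with heq | hlt
    · rw [dfsPos_injective d heq]
      exact .tail hac hcu
    · simp only [dfsPos_eq_idxOf_order] at hcx hlt
      exact .trans hac ((good_iterate_step d n).ancestor_of_between c u hcu x hcx hlt)

/-- A strongly connected component with two vertices contains the tail of a surplus edge or of an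
ancestral back edge. -/
lemma exists_edge_of_sameSCC_of_ne {d : Fin n → Fin n → Bool} (hd : ∀ i, d i i = false)
    {r u : Fin n} (hru : SameSCC d r u) (hne : r ≠ u) :
    ∃ e ∈ surplusEdges d ∪ ancestralBackEdges d, SameSCC d r e.1 := by
  by_contra! hno
  obtain ⟨v, ⟨hrv, hvr⟩, hmin⟩ := Set.exists_min_image (scc d r) (dfsPos d) (Set.toFinite _)
    ⟨r, .refl, .refl⟩
  have hanc : ∀ w, Reaches d v w → Reaches d w v → ForestAncestor d v w := by
    intro w hvw
    induction hvw with
    | refl => exact fun _ => .refl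
    | @tail b w hvb hbw ih =>
      intro hwv
      have hbv : Reaches d b v := .head hbw hwv
      rcases lt_trichotomy (dfsPos d b) (dfsPos d w) with hlt | heq | hgt
      · by_cases hf : (b, w) ∈ dfsForest d
        · exact .tail (ih hbv) hf
        · exact absurd ⟨hrv.trans hvb, hbv.trans hvr⟩
            (hno (b, w) (.inl ⟨hbw, hlt, hf⟩))
      · exact dfsPos_injective d heq ▸ ih hbv
      · exact (ih hbv).of_dfsPos_le
          (hmin w ⟨hrv.trans (hvb.tail hbw), hwv.trans hvr⟩) hgt.le
  obtain ⟨y, hry, hyr, hyv⟩ : ∃ y, Reaches d r y ∧ Reaches d y r ∧ y ≠ v := by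
    by_cases h : r = v
    · exact ⟨u, hru.1, hru.2, fun h' => hne (h.trans h'.symm)⟩
    · exact ⟨r, .refl, .refl, h⟩
  rcases (hyr.trans hrv).cases_tail with h | ⟨c, hyc, hcv⟩
  · exact hyv h.symm
  have hrc : Reaches d r c := hry.trans hyc
  have hcr : Reaches d c r := .head hcv hvr
  have hlt : dfsPos d v < dfsPos d c := by
    refine (hmin c ⟨hrc, hcr⟩).lt_of_ne fun h => ?_
    rw [dfsPos_injective d h, hd] at hcv
    cases hcv
  exact hno (c, v) (.inr ⟨hcv, hlt, hanc c (hvr.trans hrc) (hcr.trans hrv)⟩) ⟨hrc, hcr⟩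

lemma scc_eq_of_sameSCC {d : Fin n → Fin n → Bool} {u v : Fin n} (h : SameSCC d u v) :
    scc d u = scc d v :=
  Set.ext fun _ => ⟨fun hw => ⟨h.2.trans hw.1, hw.2.trans h.1⟩,
    fun hw => ⟨h.1.trans hw.1, hw.2.trans h.2⟩⟩

end DFSExploration

open DFSExploration in
/-- For any directed graph on `[n]`, the number of strongly connected
components containing at least two vertices is at most the number of surplus edges plus
the number of ancestral back edges (both taken with respect to the forward depth-first
exploration). -/
theorem card_nontrivial_scc_le_surplus_add_ancestral
    (n : ℕ) (d : Fin n → Fin n → Bool) (hd : ∀ i, d i i = false) :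
    Set.ncard {S : Set (Fin n) | ∃ v, S = scc d v ∧ 2 ≤ (scc d v).ncard}
      ≤ (surplusEdges d).ncard + (ancestralBackEdges d).ncard := by
  have hsub : {S : Set (Fin n) | ∃ v, S = scc d v ∧ 2 ≤ (scc d v).ncard} ⊆
      (fun e : Fin n × Fin n => scc d e.1) '' (surplusEdges d ∪ ancestralBackEdges d) := by
    rintro _ ⟨v, rfl, hv⟩
    obtain ⟨u, hu, huv⟩ := Set.exists_ne_of_one_lt_ncard hv v
    obtain ⟨e, he, hve⟩ := exists_edge_of_sameSCC_of_ne hd hu huv.symm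
    exact ⟨e, he, (scc_eq_of_sameSCC hve).symm⟩
  calc _ ≤ _ := Set.ncard_le_ncard hsub (Set.toFinite _)
    _ ≤ _ := Set.ncard_image_le (Set.toFinite _)
    _ ≤ _ := Set.ncard_union_le _ _
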